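/- arXiv:2308.10387 — 2 statements merged into one kernel-verified Lean document; each statement's English description precedes it below -/
import Mathlib

section
/- The linear map τ is a trace form on H_{n,r}: for all x, y ∈ H_{n,r}, τ(xy) = τ(yx). -/
open Polynomial

namespace MAK

noncomputable section

variable (R : Type*) [CommRing R] (n r : ℕ) (q Δ : Rˣ) (u : Fin r → R) (F : Fin r → R[X])

/-- The free `R`-algebra on generators `t_1, …, t_n` (left) and `T_1, …, T_{n-1}` (right). -/
abbrev FA := FreeAlgebra R (Fin n ⊕ Fin (n - 1))

/-- The generators `t_i`. -/
def tf (i : Fin n) : FA R n := FreeAlgebra.ι R (Sum.inl i)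

/-- The generators `T_j`. -/
def Tf (j : Fin (n - 1)) : FA R n := FreeAlgebra.ι R (Sum.inr j)

/-- The index `j`, viewed in `Fin n`. -/
def lo (j : Fin (n - 1)) : Fin n := ⟨j.1, by have := j.2; omega⟩

/-- The index `j + 1`, viewed in `Fin n`. -/
def hi (j : Fin (n - 1)) : Fin n := ⟨j.1 + 1, by have := j.2; omega⟩

/-- The element `B_j = Δ⁻² Σ_{c1<c2} (u_{c2} - u_{c1})(q - q⁻¹) F_{c1}(t_j) F_{c2}(t_{j+1})`. -/
def Bel (j : Fin (n - 1)) : FA R n :=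
  ∑ c2 : Fin r, ∑ c1 ∈ Finset.univ.filter (fun c1 => c1 < c2),
    (((Δ⁻¹ : Rˣ) : R) ^ 2 * ((u c2 - u c1) * ((q : R) - ((q⁻¹ : Rˣ) : R)))) •
      (aeval (tf R n (lo n j)) (F c1) * aeval (tf R n (hi n j)) (F c2))

/-- The defining relations of the modified Ariki-Koike algebra. -/
inductive Rel : FA R n → FA R n → Prop
  | quad (j : Fin (n - 1)) :
      Rel ((Tf R n j - algebraMap R (FA R n) (q : R)) *
        (Tf R n j + algebraMap R (FA R n) ((q⁻¹ : Rˣ) : R))) 0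
  | tord (i : Fin n) : Rel (aeval (tf R n i) (∏ c : Fin r, (X - C (u c)))) 0
  | braid (j k : Fin (n - 1)) (h : k.1 = j.1 + 1) :
      Rel (Tf R n j * Tf R n k * Tf R n j) (Tf R n k * Tf R n j * Tf R n k)
  | Tcomm (j k : Fin (n - 1)) (h : j.1 + 2 ≤ k.1 ∨ k.1 + 2 ≤ j.1) :
      Rel (Tf R n j * Tf R n k) (Tf R n k * Tf R n j)
  | tcomm (i i' : Fin n) : Rel (tf R n i * tf R n i') (tf R n i' * tf R n i)
  | Tt (j : Fin (n - 1)) (i : Fin n) (h1 : i ≠ lo n j) (h2 : i ≠ hi n j) :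
      Rel (Tf R n j * tf R n i) (tf R n i * Tf R n j)
  | Thi (j : Fin (n - 1)) :
      Rel (Tf R n j * tf R n (hi n j)) (tf R n (lo n j) * Tf R n j + Bel R n r q Δ u F j)
  | Tlo (j : Fin (n - 1)) :
      Rel (Tf R n j * tf R n (lo n j)) (tf R n (hi n j) * Tf R n j - Bel R n r q Δ u F j)

/-- The modified Ariki-Koike algebra `H_{n,r}(R, q, u_1, …, u_r)`. -/
abbrev Hnr := RingQuot (Rel R n r q Δ u F)

/-- The canonical projection. -/
def pim : FA R n →ₐ[R] Hnr R n r q Δ u F := RingQuot.mkAlgHom R (Rel R n r q Δ u F)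

/-- The generator `t_i` of `H_{n,r}`. -/
def tt (i : Fin n) : Hnr R n r q Δ u F := pim R n r q Δ u F (tf R n i)

/-- The generator `T_j` of `H_{n,r}`. -/
def TT (j : Fin (n - 1)) : Hnr R n r q Δ u F := pim R n r q Δ u F (Tf R n j)

/-- The Lagrange basis polynomial `∏_{j ≠ c} (X - u_j)/(u_c - u_j)`. -/
def bpoly (c : Fin r) : R[X] :=
  ∏ j ∈ Finset.univ.filter (fun j => j ≠ c), Ring.inverse (u c - u j) • (X - C (u j))

/-- The idempotent `b_{k_1, …, k_n}`. -/
def b (k : Fin n → Fin r) : Hnr R n r q Δ u F :=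
  (List.ofFn fun i : Fin n => aeval (tt R n r q Δ u F i) (bpoly R r u (k i))).prod

/-- The element `B'_{i,j} = -(q - q⁻¹) Σ_{k_i < k_j} b_{k_1, …, k_n}`. -/
def B' (i j : Fin n) : Hnr R n r q Δ u F :=
  -(((q : R) - ((q⁻¹ : Rˣ) : R)) •
    ∑ k ∈ Finset.univ.filter (fun k : Fin n → Fin r => k i < k j), b R n r q Δ u F k)

/-- The element `g_i := T_i + B'_{i,i+1}`. -/
def g (j : Fin (n - 1)) : Hnr R n r q Δ u F :=
  TT R n r q Δ u F j + B' R n r q Δ u F (lo n j) (hi n j)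

/-- The idempotent `e_{i,j} = Σ_{k_i = k_j} b_{k_1, …, k_n}`. -/
def eij (i j : Fin n) : Hnr R n r q Δ u F :=
  ∑ k ∈ Finset.univ.filter (fun k : Fin n → Fin r => k i = k j), b R n r q Δ u F k

/-- The idempotent `e_i = e_{i,i+1}`. -/
def ee (j : Fin (n - 1)) : Hnr R n r q Δ u F := eij R n r q Δ u F (lo n j) (hi n j)

/-- The simple transposition `s_j = (j, j+1)` in `S_n`. -/
def simple (j : Fin (n - 1)) : Equiv.Perm (Fin n) := Equiv.swap (lo n j) (hi n j)

/-- `l` is a reduced word for the permutation `w`. -/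
def IsReducedWord (w : Equiv.Perm (Fin n)) (l : List (Fin (n - 1))) : Prop :=
  (l.map (simple n)).prod = w ∧
    ∀ l' : List (Fin (n - 1)), (l'.map (simple n)).prod = w → l.length ≤ l'.length

/-- The element `g_w = g_{i_1} ⋯ g_{i_l}` associated to a word `l = (i_1, …, i_l)`. -/
def gword (l : List (Fin (n - 1))) : Hnr R n r q Δ u F := (l.map (g R n r q Δ u F)).prod

/-- The element `T_w = T_{i_1} ⋯ T_{i_l}` associated to a word `l = (i_1, …, i_l)`. -/
def Tword (l : List (Fin (n - 1))) : Hnr R n r q Δ u F := (l.map (TT R n r q Δ u F)).prod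

/-- The monomial `t_1^{c_1} ⋯ t_n^{c_n}`. -/
def tmon (c : Fin n → ℕ) : Hnr R n r q Δ u F :=
  (List.ofFn fun i : Fin n => tt R n r q Δ u F i ^ c i).prod

end

end MAK

open MAK

namespace MAK

section Words

variable {n : ℕ}

/-- The inversions of a permutation of `Fin n`. -/
def inversions (w : Equiv.Perm (Fin n)) : Finset (Fin n × Fin n) :=
  Finset.univ.filter fun p => p.1 < p.2 ∧ w p.2 < w p.1

lemma mem_inversions {w : Equiv.Perm (Fin n)} {a b : Fin n} :
    (a, b) ∈ inversions w ↔ a < b ∧ w b < w a := by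
  rw [inversions, Finset.mem_filter]
  simp

/-- `j` is a left descent of `w`. -/
def LeftDescent (w : Equiv.Perm (Fin n)) (j : Fin (n - 1)) : Prop :=
  w⁻¹ (hi n j) < w⁻¹ (lo n j)

lemma lo_ne_hi (j : Fin (n - 1)) : lo n j ≠ hi n j := by
  simp [lo, hi, Fin.ext_iff]

lemma simple_mul_self (j : Fin (n - 1)) : simple n j * simple n j = 1 := by
  simp [simple]

lemma simple_inv (j : Fin (n - 1)) : (simple n j)⁻¹ = simple n j := by
  simp [simple]

lemma simple_lo (j : Fin (n - 1)) : simple n j (lo n j) = hi n j := by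
  simp [simple]

lemma simple_hi (j : Fin (n - 1)) : simple n j (hi n j) = lo n j := by
  simp [simple]

lemma simple_mul_cancel (j : Fin (n - 1)) (w : Equiv.Perm (Fin n)) :
    simple n j * (simple n j * w) = w := by
  rw [← mul_assoc, simple_mul_self, one_mul]

lemma card_inversions_simple_mul {w : Equiv.Perm (Fin n)} {j : Fin (n - 1)}
    (h : ¬ LeftDescent w j) :
    (inversions (simple n j * w)).card = (inversions w).card + 1 := by
  have h' : w⁻¹ (lo n j) < w⁻¹ (hi n j) :=
    lt_of_le_of_ne (not_lt.1 h) fun e => lo_ne_hi j (w⁻¹.injective e)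
  have hnm : (w⁻¹ (lo n j), w⁻¹ (hi n j)) ∉ inversions w := by
    simp [inversions, lo, hi]
  rw [← Finset.card_insert_of_notMem hnm]
  congr 1
  ext ⟨a, b⟩
  simp only [mem_inversions, Finset.mem_insert,
    Prod.mk.injEq, Equiv.Perm.eq_inv_iff_eq, Equiv.Perm.mul_apply, simple, Equiv.swap_apply_def]
  have key : ∀ {a b : Fin n}, w a = lo n j → w b = hi n j → a < b := by
    intro a b ha hb
    rwa [← ha, ← hb, Equiv.Perm.inv_def, Equiv.symm_apply_apply, Equiv.symm_apply_apply] at h'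
  have k1 := @key a b
  have k2 := @key b a
  have hab : w a = w b → a = b := fun e => w.injective e
  clear key h h' hnm
  generalize w a = x at *
  generalize w b = y at *
  simp only [lo, hi, Fin.ext_iff, Fin.lt_def] at *
  have := j.2
  split_ifs <;> simp_all <;> omega

lemma leftDescent_simple_mul {w : Equiv.Perm (Fin n)} {j : Fin (n - 1)} :
    LeftDescent (simple n j * w) j ↔ ¬ LeftDescent w j := by
  simp only [LeftDescent, mul_inv_rev, simple_inv, Equiv.Perm.mul_apply, simple_lo, simple_hi]
  rw [not_lt]
  exact ⟨le_of_lt, fun h => lt_of_le_of_ne h fun e => lo_ne_hi j (w⁻¹.injective e)⟩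

lemma card_inversions_of_leftDescent {w : Equiv.Perm (Fin n)} {j : Fin (n - 1)}
    (h : LeftDescent w j) :
    (inversions w).card = (inversions (simple n j * w)).card + 1 := by
  have := card_inversions_simple_mul (w := simple n j * w) (j := j)
    (by rw [leftDescent_simple_mul]; exact not_not.2 h)
  rwa [simple_mul_cancel] at this

lemma exists_leftDescent {w : Equiv.Perm (Fin n)} (hw : w ≠ 1) : ∃ j, LeftDescent w j := by
  by_contra! h
  obtain _ | m := n
  · exact hw (Subsingleton.elim _ _)
  have hm : StrictMono (w⁻¹ : Equiv.Perm (Fin (m + 1))) := by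
    rw [Fin.strictMono_iff_lt_succ]
    intro i
    exact lt_of_le_of_ne (not_lt.1 (h i)) fun e => lo_ne_hi (n := m + 1) i (w⁻¹.injective e)
  have h1 : (w⁻¹ : Equiv.Perm (Fin (m + 1))) = 1 := by
    have hid : hm.orderIsoOfSurjective _ (w⁻¹).surjective = OrderIso.refl _ :=
      Subsingleton.elim _ _
    ext x
    exact congrArg Fin.val (DFunLike.congr_fun hid x)
  exact hw (inv_eq_one.1 h1)

@[simp]
lemma inversions_one : inversions (1 : Equiv.Perm (Fin n)) = ∅ := by
  ext ⟨a, b⟩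
  simpa [mem_inversions] using fun h : a < b => h.le

lemma exists_word (w : Equiv.Perm (Fin n)) :
    ∃ l : List (Fin (n - 1)), (l.map (simple n)).prod = w ∧ l.length = (inversions w).card := by
  induction hN : (inversions w).card generalizing w with
  | zero =>
    refine ⟨[], ?_, rfl⟩
    by_contra hw
    obtain ⟨j, hj⟩ := exists_leftDescent (Ne.symm hw)
    have := card_inversions_of_leftDescent hj
    omega
  | succ N ih =>
    have hw : w ≠ 1 := by rintro rfl; simp at hN
    obtain ⟨j, hj⟩ := exists_leftDescent hw
    have := card_inversions_of_leftDescent hj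
    obtain ⟨l, hl, hl'⟩ := ih (simple n j * w) (by omega)
    exact ⟨j :: l, by simp [hl, simple_mul_cancel], by simp [hl']⟩

lemma card_inversions_le (l : List (Fin (n - 1))) :
    (inversions (l.map (simple n)).prod).card ≤ l.length := by
  induction l with
  | nil => simp
  | cons j l ih =>
    rw [List.map_cons, List.prod_cons, List.length_cons]
    by_cases h : LeftDescent (l.map (simple n)).prod j
    · have := card_inversions_of_leftDescent h
      omega
    · have := card_inversions_simple_mul h
      omega

lemma isReducedWord_iff {w : Equiv.Perm (Fin n)} {l : List (Fin (n - 1))} :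
    IsReducedWord n w l ↔ (l.map (simple n)).prod = w ∧ l.length = (inversions w).card := by
  refine and_congr_right fun h => ⟨fun hl => ?_, fun hl l' hl' => ?_⟩
  · obtain ⟨m, hm, hm'⟩ := exists_word w
    refine le_antisymm (hm' ▸ hl m hm) ?_
    rw [← h]
    exact card_inversions_le l
  · rw [hl, ← hl']
    exact card_inversions_le l'

lemma exists_isReducedWord (w : Equiv.Perm (Fin n)) : ∃ l, IsReducedWord n w l := by
  obtain ⟨l, hl⟩ := exists_word w
  exact ⟨l, isReducedWord_iff.2 hl⟩

lemma isReducedWord_cons {w : Equiv.Perm (Fin n)} {j : Fin (n - 1)} {l : List (Fin (n - 1))} :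
    IsReducedWord n w (j :: l) ↔ LeftDescent w j ∧ IsReducedWord n (simple n j * w) l := by
  simp only [isReducedWord_iff, List.map_cons, List.prod_cons, List.length_cons]
  constructor
  · rintro ⟨rfl, hl⟩
    have hle := card_inversions_le l
    have hd : LeftDescent (simple n j * (l.map (simple n)).prod) j := by
      by_contra hd
      have := card_inversions_simple_mul hd
      rw [simple_mul_cancel] at this
      omega
    have := card_inversions_of_leftDescent hd
    rw [simple_mul_cancel] at this ⊢
    exact ⟨hd, rfl, by omega⟩
  · rintro ⟨hd, hl, hl'⟩
    have := card_inversions_of_leftDescent hd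
    exact ⟨by rw [hl, simple_mul_cancel], by omega⟩

lemma isReducedWord_cons_of_not_leftDescent {w : Equiv.Perm (Fin n)} {j : Fin (n - 1)}
    {l : List (Fin (n - 1))} (h : ¬ LeftDescent w j) (hl : IsReducedWord n w l) :
    IsReducedWord n (simple n j * w) (j :: l) :=
  isReducedWord_cons.2 ⟨leftDescent_simple_mul.2 h, by rwa [simple_mul_cancel]⟩

lemma not_leftDescent_one (j : Fin (n - 1)) : ¬ LeftDescent (1 : Equiv.Perm (Fin n)) j := by
  simp [LeftDescent, lo, hi]

lemma isReducedWord_nil : IsReducedWord n 1 [] := by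
  simp [isReducedWord_iff]

lemma prod_map_simple_reverse (l : List (Fin (n - 1))) :
    (l.reverse.map (simple n)).prod = ((l.map (simple n)).prod)⁻¹ := by
  rw [List.prod_inv_reverse, List.map_reverse, List.map_map]
  congr 3

lemma IsReducedWord.reverse {w : Equiv.Perm (Fin n)} {l : List (Fin (n - 1))}
    (hl : IsReducedWord n w l) : IsReducedWord n w⁻¹ l.reverse := by
  refine ⟨by rw [prod_map_simple_reverse, hl.1], fun l' hl' => ?_⟩
  rw [List.length_reverse, ← l'.length_reverse]
  exact hl.2 _ (by rw [prod_map_simple_reverse, hl', inv_inv])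

lemma leftDescent_simple_mul_of_far {w : Equiv.Perm (Fin n)} {i j : Fin (n - 1)}
    (h : i.1 + 2 ≤ j.1 ∨ j.1 + 2 ≤ i.1) :
    LeftDescent (simple n i * w) j ↔ LeftDescent w j := by
  have h1 : simple n i (lo n j) = lo n j :=
    Equiv.swap_apply_of_ne_of_ne (by simp [lo, Fin.ext_iff]; omega)
      (by simp [lo, hi, Fin.ext_iff]; omega)
  have h2 : simple n i (hi n j) = hi n j :=
    Equiv.swap_apply_of_ne_of_ne (by simp [lo, hi, Fin.ext_iff]; omega)
      (by simp [hi, Fin.ext_iff]; omega)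
  simp [LeftDescent, simple_inv, h1, h2]

lemma simple_comm_of_far {i j : Fin (n - 1)} (h : i.1 + 2 ≤ j.1 ∨ j.1 + 2 ≤ i.1) :
    simple n i * simple n j = simple n j * simple n i := by
  apply Equiv.Perm.Disjoint.commute
  intro x
  simp only [simple, lo, hi, Equiv.swap_apply_def]
  have := i.2
  simp only [Fin.ext_iff]
  split_ifs <;> simp <;> omega

lemma hi_eq_lo {i j : Fin (n - 1)} (h : j.1 = i.1 + 1) : hi n i = lo n j := by
  simp [hi, lo, h]

lemma simple_lo_of_adj {i j : Fin (n - 1)} (h : j.1 = i.1 + 1) :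
    simple n j (lo n i) = lo n i :=
  Equiv.swap_apply_of_ne_of_ne (by simp [lo, Fin.ext_iff]; omega)
    (by simp [lo, hi, Fin.ext_iff]; omega)

lemma simple_hi_of_adj {i j : Fin (n - 1)} (h : j.1 = i.1 + 1) :
    simple n i (hi n j) = hi n j :=
  Equiv.swap_apply_of_ne_of_ne (by simp [lo, hi, Fin.ext_iff]; omega)
    (by simp [hi, Fin.ext_iff]; omega)

lemma simple_braid {i j : Fin (n - 1)} (h : j.1 = i.1 + 1) :
    simple n i * simple n j * simple n i = simple n j * simple n i * simple n j := by
  have h1 : simple n i * simple n j * simple n i = Equiv.swap (lo n i) (hi n j) := by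
    have := Equiv.swap_apply_apply (simple n i) (lo n j) (hi n j)
    rw [simple_inv, simple_hi_of_adj h] at this
    rw [← simple_hi, hi_eq_lo h, this]
    rfl
  have h2 : simple n j * simple n i * simple n j = Equiv.swap (lo n i) (hi n j) := by
    have := Equiv.swap_apply_apply (simple n j) (lo n i) (hi n i)
    rw [simple_inv, simple_lo_of_adj h] at this
    rw [← simple_lo, ← hi_eq_lo h, this]
    rfl
  rw [h1, h2]

variable {M : Type*} [Monoid M] {γ : Fin (n - 1) → M}

lemma prod_eq_prod_of_adj
    (braid : ∀ i j : Fin (n - 1), j.1 = i.1 + 1 → γ i * γ j * γ i = γ j * γ i * γ j)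
    {N : ℕ}
    (ih : ∀ (w : Equiv.Perm (Fin n)) (l m : List (Fin (n - 1))), l.length = N →
      IsReducedWord n w l → IsReducedWord n w m → (l.map γ).prod = (m.map γ).prod)
    {w : Equiv.Perm (Fin n)} {i j : Fin (n - 1)} (hij : j.1 = i.1 + 1)
    {l m : List (Fin (n - 1))} (hlN : l.length = N) (hmN : m.length = N)
    (hl : IsReducedWord n w (i :: l)) (hm : IsReducedWord n w (j :: m)) :
    γ i * (l.map γ).prod = γ j * (m.map γ).prod := by
  rw [isReducedWord_cons] at hl hm
  obtain ⟨hi1, hl⟩ := hl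
  obtain ⟨hj1, hm⟩ := hm
  obtain ⟨v, hv⟩ := exists_isReducedWord (simple n i * (simple n j * (simple n i * w)))
  have hv' : IsReducedWord n (simple n j * (simple n i * (simple n j * w))) v := by
    rwa [← mul_assoc, ← mul_assoc, ← simple_braid hij, mul_assoc, mul_assoc]
  have hb := hi_eq_lo hij
  have hL : IsReducedWord n (simple n i * w) (j :: i :: v) := by
    refine isReducedWord_cons.2 ⟨?_, isReducedWord_cons.2 ⟨?_, hv⟩⟩ <;>
      simp only [LeftDescent, mul_inv_rev, simple_inv, Equiv.Perm.mul_apply] at hi1 hj1 ⊢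
    · rw [simple_hi_of_adj hij, ← hb, simple_hi]
      rw [← hb] at hj1
      exact hj1.trans hi1
    · rw [simple_lo_of_adj hij, simple_lo, hb, simple_lo, simple_hi_of_adj hij]
      exact hj1
  have hM : IsReducedWord n (simple n j * w) (i :: j :: v) := by
    refine isReducedWord_cons.2 ⟨?_, isReducedWord_cons.2 ⟨?_, hv'⟩⟩ <;>
      simp only [LeftDescent, mul_inv_rev, simple_inv, Equiv.Perm.mul_apply] at hi1 hj1 ⊢
    · rw [simple_lo_of_adj hij, hb, simple_lo]
      rw [hb] at hi1
      exact hj1.trans hi1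
    · rw [simple_hi_of_adj hij, simple_hi, ← hb, simple_hi, simple_lo_of_adj hij]
      exact hi1
  rw [ih _ _ _ hlN hl hL, ih _ _ _ hmN hm hM]
  simp only [List.map_cons, List.prod_cons, ← mul_assoc]
  rw [braid i j hij]

/-- Matsumoto's theorem for the symmetric group. -/
theorem prod_eq_prod_of_isReducedWord
    (braid : ∀ i j : Fin (n - 1), j.1 = i.1 + 1 → γ i * γ j * γ i = γ j * γ i * γ j)
    (comm : ∀ i j : Fin (n - 1), i.1 + 2 ≤ j.1 ∨ j.1 + 2 ≤ i.1 → γ i * γ j = γ j * γ i)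
    {w : Equiv.Perm (Fin n)} {l m : List (Fin (n - 1))}
    (hl : IsReducedWord n w l) (hm : IsReducedWord n w m) :
    (l.map γ).prod = (m.map γ).prod := by
  induction hN : l.length generalizing w l m with
  | zero =>
    have h1 := (isReducedWord_iff.1 hl).2
    have h2 := (isReducedWord_iff.1 hm).2
    rw [List.length_eq_zero_iff.1 hN, List.length_eq_zero_iff.1 (h2.trans (h1.symm.trans hN))]
  | succ N ih =>
    have hlen : m.length = N + 1 := by
      rw [← hN, (isReducedWord_iff.1 hl).2, (isReducedWord_iff.1 hm).2]
    obtain ⟨i, l, rfl⟩ := List.exists_cons_of_length_eq_add_one hN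
    obtain ⟨j, m, rfl⟩ := List.exists_cons_of_length_eq_add_one hlen
    simp only [List.length_cons, Nat.add_right_cancel_iff] at hN hlen
    simp only [List.map_cons, List.prod_cons]
    have ih' : ∀ (w : Equiv.Perm (Fin n)) (l m : List (Fin (n - 1))), l.length = N →
        IsReducedWord n w l → IsReducedWord n w m → (l.map γ).prod = (m.map γ).prod :=
      fun _ _ _ h hl hm => ih hl hm h
    rcases eq_or_ne i j with rfl | hne
    · rw [ih (isReducedWord_cons.1 hl).2 (isReducedWord_cons.1 hm).2 hN]
    by_cases hij : j.1 = i.1 + 1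
    · exact prod_eq_prod_of_adj braid ih' hij hN hlen hl hm
    by_cases hji : i.1 = j.1 + 1
    · exact (prod_eq_prod_of_adj braid ih' hji hlen hN hm hl).symm
    have hfar : i.1 + 2 ≤ j.1 ∨ j.1 + 2 ≤ i.1 := by
      have := fun h => hne (Fin.ext h)
      omega
    obtain ⟨hi1, hl⟩ := isReducedWord_cons.1 hl
    obtain ⟨hj1, hm⟩ := isReducedWord_cons.1 hm
    obtain ⟨v, hv⟩ := exists_isReducedWord (simple n i * (simple n j * w))
    have hv' : IsReducedWord n (simple n j * (simple n i * w)) v := by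
      rwa [← mul_assoc, ← simple_comm_of_far hfar, mul_assoc]
    rw [ih hl (isReducedWord_cons.2 ⟨(leftDescent_simple_mul_of_far hfar).2 hj1, hv'⟩) hN,
      ih hm (isReducedWord_cons.2 ⟨(leftDescent_simple_mul_of_far hfar.symm).2 hi1, hv⟩) hlen]
    simp only [List.map_cons, List.prod_cons, ← mul_assoc]
    rw [comm i j hfar]

end Words

end MAK

namespace MAK

section Trace

variable {R : Type*} [CommRing R] {n r : ℕ} {H : Type*} [Ring H] [Algebra R H]

/-- The elements `γ j` intertwine the image of `Φ` and satisfy the braid relations and quadratic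
relations with coefficients in the image of `Φ`. -/
structure IsHeckeFamily (Φ : ((Fin n → Fin r) → R) →ₐ[R] H) (γ : Fin (n - 1) → H)
    (e : Fin (n - 1) → (Fin n → Fin r) → R) : Prop where
  inter : ∀ j f, γ j * Φ f = Φ (fun k => f (k ∘ simple n j)) * γ j
  quad : ∀ j, γ j * γ j = 1 + Φ (e j) * γ j
  braid : ∀ i j : Fin (n - 1), j.1 = i.1 + 1 → γ i * γ j * γ i = γ j * γ i * γ j
  comm : ∀ i j : Fin (n - 1), i.1 + 2 ≤ j.1 ∨ j.1 + 2 ≤ i.1 → γ i * γ j = γ j * γ i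

namespace IsHeckeFamily

variable {Φ : ((Fin n → Fin r) → R) →ₐ[R] H} {γ : Fin (n - 1) → H}
  {e : Fin (n - 1) → (Fin n → Fin r) → R} (hγ : IsHeckeFamily Φ γ e)

/-- The span of the elements `Φ f * γ_w`, with `γ_w` given by reduced words. -/
def reducedSpan (Φ : ((Fin n → Fin r) → R) →ₐ[R] H) (γ : Fin (n - 1) → H) : Submodule R H :=
  Submodule.span R {x | ∃ f w l, IsReducedWord n w l ∧ x = Φ f * (l.map γ).prod}

lemma mul_mem_reducedSpan {f : (Fin n → Fin r) → R} {w : Equiv.Perm (Fin n)}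
    {l : List (Fin (n - 1))} (hl : IsReducedWord n w l) :
    Φ f * (l.map γ).prod ∈ reducedSpan Φ γ :=
  Submodule.subset_span ⟨f, w, l, hl, rfl⟩

lemma apply_mul_mem {x : H} (hx : x ∈ reducedSpan Φ γ) (f : (Fin n → Fin r) → R) :
    Φ f * x ∈ reducedSpan Φ γ := by
  induction hx using Submodule.span_induction with
  | mem x hx =>
    obtain ⟨f', w, l, hl, rfl⟩ := hx
    rw [← mul_assoc, ← map_mul]
    exact mul_mem_reducedSpan hl
  | zero => simp
  | add x y _ _ hx hy => rw [mul_add]; exact add_mem hx hy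
  | smul a x _ hx => rw [mul_smul_comm]; exact Submodule.smul_mem _ _ hx

include hγ

lemma prod_mul_apply (l : List (Fin (n - 1))) (f : (Fin n → Fin r) → R) :
    (l.map γ).prod * Φ f = Φ (fun k => f (k ∘ (l.map (simple n)).prod)) * (l.map γ).prod := by
  induction l generalizing f with
  | nil => simp
  | cons j l ih =>
    rw [List.map_cons, List.prod_cons, mul_assoc, ih, ← mul_assoc, hγ.inter, mul_assoc]
    rfl

lemma exists_eq_cons {w : Equiv.Perm (Fin n)} {l : List (Fin (n - 1))}
    (hl : IsReducedWord n w l) {j : Fin (n - 1)} (hj : LeftDescent w j) :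
    ∃ l', IsReducedWord n (simple n j * w) l' ∧ (l.map γ).prod = γ j * (l'.map γ).prod := by
  obtain ⟨l', hl'⟩ := exists_isReducedWord (simple n j * w)
  refine ⟨l', hl', ?_⟩
  rw [prod_eq_prod_of_isReducedWord hγ.braid hγ.comm hl (isReducedWord_cons.2 ⟨hj, hl'⟩),
    List.map_cons, List.prod_cons]

lemma exists_eq_concat {w : Equiv.Perm (Fin n)} {l : List (Fin (n - 1))}
    (hl : IsReducedWord n w l) {j : Fin (n - 1)} (hj : LeftDescent w⁻¹ j) :
    ∃ l', IsReducedWord n (w * simple n j) l' ∧ (l.map γ).prod = (l'.map γ).prod * γ j := by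
  obtain ⟨l', hl'⟩ := exists_isReducedWord (w * simple n j)
  have h : IsReducedWord n w⁻¹ (j :: l'.reverse) :=
    isReducedWord_cons.2 ⟨hj, by simpa [simple_inv] using hl'.reverse⟩
  refine ⟨l', hl', ?_⟩
  rw [prod_eq_prod_of_isReducedWord hγ.braid hγ.comm hl (by simpa using h.reverse)]
  simp

lemma mul_mem {x : H} (hx : x ∈ reducedSpan Φ γ) (j : Fin (n - 1)) :
    γ j * x ∈ reducedSpan Φ γ := by
  induction hx using Submodule.span_induction with
  | mem x hx =>
    obtain ⟨f, w, l, hl, rfl⟩ := hx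
    rw [← mul_assoc, hγ.inter, mul_assoc]
    apply apply_mul_mem
    by_cases hj : LeftDescent w j
    · obtain ⟨l', hl', h⟩ := hγ.exists_eq_cons hl hj
      rw [h, ← mul_assoc, hγ.quad, add_mul, one_mul, mul_assoc, ← h]
      exact add_mem (by simpa using mul_mem_reducedSpan (Φ := Φ) (γ := γ) (f := 1) hl')
        (mul_mem_reducedSpan hl)
    · simpa using mul_mem_reducedSpan (Φ := Φ) (γ := γ) (f := 1)
        (isReducedWord_cons_of_not_leftDescent hj hl)
  | zero => simp
  | add x y _ _ hx hy => rw [mul_add]; exact add_mem hx hy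
  | smul a x _ hx => rw [mul_smul_comm]; exact Submodule.smul_mem _ _ hx

lemma reducedSpan_eq_top (hgen : Algebra.adjoin R (Set.range Φ ∪ Set.range γ) = ⊤) :
    reducedSpan Φ γ = ⊤ := by
  have key : ∀ y ∈ Algebra.adjoin R (Set.range Φ ∪ Set.range γ), ∀ x ∈ reducedSpan Φ γ,
      y * x ∈ reducedSpan Φ γ := by
    intro y hy
    induction hy using Algebra.adjoin_induction with
    | mem y hy =>
      rintro x hx
      obtain ⟨f, rfl⟩ | ⟨j, rfl⟩ := hy
      · exact apply_mul_mem hx f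
      · exact hγ.mul_mem hx j
    | algebraMap a =>
      intro x hx
      rw [← Algebra.smul_def]
      exact Submodule.smul_mem _ _ hx
    | add y z _ _ hy hz => intro x hx; rw [add_mul]; exact add_mem (hy x hx) (hz x hx)
    | mul y z _ _ hy hz => intro x hx; rw [mul_assoc]; exact hy _ (hz x hx)
  refine eq_top_iff.2 fun y _ => ?_
  have := key y (hgen ▸ Algebra.mem_top) 1
    (by simpa using mul_mem_reducedSpan (Φ := Φ) (γ := γ) (f := 1) isReducedWord_nil)
  rwa [mul_one] at this

variable {ω : (Fin n → Fin r) → R} {τ : H →ₗ[R] R}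

lemma trace_mul_left
    (hτ : ∀ f w l, IsReducedWord n w l →
      τ (Φ f * (l.map γ).prod) = if w = 1 then ∑ k, f k * ω k else 0)
    {w : Equiv.Perm (Fin n)} {l : List (Fin (n - 1))} (hl : IsReducedWord n w l)
    (f : (Fin n → Fin r) → R) (j : Fin (n - 1)) :
    τ (Φ f * (γ j * (l.map γ).prod)) = if w = simple n j then ∑ k, f k * ω k else 0 := by
  have hiff : simple n j * w = 1 ↔ w = simple n j := by
    rw [mul_eq_one_iff_eq_inv', simple_inv]
  by_cases hj : LeftDescent w j
  · obtain ⟨l', hl', h⟩ := hγ.exists_eq_cons hl hj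
    have hw : w ≠ 1 := by rintro rfl; exact not_leftDescent_one j hj
    rw [h, ← mul_assoc (γ j), hγ.quad, add_mul, one_mul, mul_assoc, ← h, mul_add, map_add,
      ← mul_assoc, ← map_mul, hτ _ _ _ hl, hτ _ _ _ hl', if_neg hw, add_zero]
    simp only [hiff]
  · have hw : w ≠ simple n j := by
      rintro rfl
      rw [← mul_one (simple n j), leftDescent_simple_mul] at hj
      exact hj (not_leftDescent_one j)
    have := hτ f _ _ (isReducedWord_cons_of_not_leftDescent hj hl)
    rw [if_neg (hiff.not.2 hw)] at this
    simpa [hw] using this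

lemma trace_mul_right
    (hτ : ∀ f w l, IsReducedWord n w l →
      τ (Φ f * (l.map γ).prod) = if w = 1 then ∑ k, f k * ω k else 0)
    {w : Equiv.Perm (Fin n)} {l : List (Fin (n - 1))} (hl : IsReducedWord n w l)
    (f : (Fin n → Fin r) → R) (j : Fin (n - 1)) :
    τ (Φ f * ((l.map γ).prod * γ j)) = if w = simple n j then ∑ k, f k * ω k else 0 := by
  have hiff : w * simple n j = 1 ↔ w = simple n j := by
    rw [mul_eq_one_iff_eq_inv, simple_inv]
  by_cases hj : LeftDescent w⁻¹ j
  · obtain ⟨l', hl', h⟩ := hγ.exists_eq_concat hl hj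
    have hw : w ≠ 1 := by rintro rfl; exact not_leftDescent_one j (by simpa using hj)
    rw [h, mul_assoc _ (γ j), hγ.quad, mul_add, mul_one, ← mul_assoc _ (Φ _), hγ.prod_mul_apply,
      mul_assoc (Φ _), ← h, mul_add, map_add, ← mul_assoc, ← map_mul, hτ _ _ _ hl, hτ _ _ _ hl',
      if_neg hw, add_zero]
    simp only [hiff]
  · have hw : w ≠ simple n j := by
      rintro rfl
      rw [simple_inv, ← mul_one (simple n j), leftDescent_simple_mul] at hj
      exact hj (not_leftDescent_one j)
    have h := (isReducedWord_cons_of_not_leftDescent hj hl.reverse).reverse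
    simp only [mul_inv_rev, inv_inv, simple_inv, List.reverse_cons, List.reverse_reverse] at h
    have := hτ f _ _ h
    rw [if_neg (hiff.not.2 hw)] at this
    simpa [hw] using this

theorem trace_mul_comm (hgen : Algebra.adjoin R (Set.range Φ ∪ Set.range γ) = ⊤)
    (hω : ∀ (j : Fin (n - 1)) k, ω (k ∘ simple n j) = ω k)
    (hτ : ∀ f w l, IsReducedWord n w l →
      τ (Φ f * (l.map γ).prod) = if w = 1 then ∑ k, f k * ω k else 0) (x y : H) :
    τ (x * y) = τ (y * x) := by
  suffices key : ∀ y ∈ Algebra.adjoin R (Set.range Φ ∪ Set.range γ), ∀ x,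
      τ (x * y) = τ (y * x) from key y (hgen ▸ Algebra.mem_top) x
  intro y hy
  induction hy using Algebra.adjoin_induction with
  | mem y hy =>
    intro x
    have hx : x ∈ reducedSpan Φ γ := hγ.reducedSpan_eq_top hgen ▸ Submodule.mem_top
    induction hx using Submodule.span_induction with
    | mem x hx =>
      obtain ⟨f, w, l, hl, rfl⟩ := hx
      obtain ⟨f', rfl⟩ | ⟨j, rfl⟩ := hy
      · rw [mul_assoc, hγ.prod_mul_apply, ← mul_assoc, ← mul_assoc, ← map_mul, ← map_mul,
          hτ _ _ _ hl, hτ _ _ _ hl, hl.1]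
        split_ifs with hw
        · subst hw
          refine Finset.sum_congr rfl fun k _ => ?_
          simp [mul_comm]
        · rfl
      · rw [mul_assoc, hγ.trace_mul_right hτ hl, ← mul_assoc, hγ.inter, mul_assoc,
          hγ.trace_mul_left hτ hl]
        split_ifs
        · refine Fintype.sum_equiv ((simple n j).arrowCongr (Equiv.refl _)) _ _ fun k => ?_
          have h1 : (k ∘ simple n j) ∘ simple n j = k := by
            funext i
            simp [simple]
          have h2 : (simple n j).arrowCongr (Equiv.refl _) k = k ∘ simple n j := by
            funext i
            simp [simple]
          rw [h2, h1, hω]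
        · rfl
    | zero => simp
    | add x y _ _ hx hy => rw [add_mul, mul_add, map_add, map_add, hx, hy]
    | smul a x _ hx => rw [mul_smul_comm, smul_mul_assoc, map_smul, map_smul, hx]
  | algebraMap a => intro x; rw [Algebra.commutes]
  | add y z _ _ hy hz => intro x; rw [add_mul, mul_add, map_add, map_add, hy, hz]
  | mul y z _ _ hy hz => intro x; rw [← mul_assoc, hz, ← mul_assoc, hy, mul_assoc]

end IsHeckeFamily

end Trace

end MAK

namespace MAK

section Coordinates

variable {R : Type*} [CommRing R] {n r : ℕ} {u : Fin r → R}

lemma bpoly_eval (hu : ∀ c c', c ≠ c' → IsUnit (u c - u c')) (c c' : Fin r) :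
    (bpoly R r u c).eval (u c') = if c' = c then 1 else 0 := by
  rw [bpoly, eval_prod]
  split_ifs with h
  · subst h
    refine Finset.prod_eq_one fun j hj => ?_
    simp [Ring.inverse_mul_cancel _ (hu _ _ (Finset.mem_filter.1 hj).2.symm)]
  · exact Finset.prod_eq_zero (i := c') (by simpa using h) (by simp)

lemma natDegree_bpoly_lt (c : Fin r) : (bpoly R r u c).natDegree < r := by
  have hc : (Finset.univ.filter fun j => j ≠ c).card < r := by
    conv_rhs => rw [← Fintype.card_fin r, ← Finset.card_univ]
    exact Finset.card_lt_card (Finset.filter_ssubset.2 ⟨c, by simp⟩)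
  refine lt_of_le_of_lt (natDegree_prod_le _ _) (lt_of_le_of_lt (Finset.sum_le_card_nsmul _ _ 1
    fun j _ => ?_) (by simpa using hc))
  exact (natDegree_smul_le _ _).trans (natDegree_X_sub_C_le _)

lemma sum_bpoly [IsDomain R] (hr : 1 ≤ r) (hu : ∀ c c', c ≠ c' → IsUnit (u c - u c')) :
    ∑ c, bpoly R r u c = 1 := by
  have hinj : Function.Injective u := by
    intro c c' h
    by_contra hne
    exact not_isUnit_zero (sub_self (u c') ▸ h ▸ hu c c' hne)
  refine eq_of_natDegree_lt_card_of_eval_eq _ _ hinj (fun c' => ?_) ?_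
  · simp [eval_finsetSum, bpoly_eval hu]
  · rw [Fintype.card_fin, natDegree_one, max_lt_iff]
    refine ⟨lt_of_le_of_lt (natDegree_sum_le_of_forall_le _ _ (n := r - 1) fun c _ => ?_)
      (by omega), by omega⟩
    have := natDegree_bpoly_lt (u := u) c
    omega

lemma X_sub_C_mul_bpoly (c : Fin r) :
    ∃ a : R, (X - C (u c)) * bpoly R r u c = a • ∏ c, (X - C (u c)) := by
  refine ⟨∏ j ∈ Finset.univ.filter (fun j => j ≠ c), Ring.inverse (u c - u j), ?_⟩
  rw [bpoly, Finset.prod_smul, mul_smul_comm, Finset.filter_ne',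
    Finset.mul_prod_erase _ (fun c => X - C (u c)) (Finset.mem_univ c)]

/-- A family of `n` elements of a commutative algebra, each a root of `∏ (X - u_c)`, is the image
of the family of coordinates of the grid `u(Fin r)ⁿ`. -/
lemma exists_gridHom_of_comm [IsDomain R] (hr : 1 ≤ r)
    (hu : ∀ c c', c ≠ c' → IsUnit (u c - u c')) {A : Type*} [CommRing A] [Algebra R A]
    (t : Fin n → A) (ht : ∀ i, aeval (t i) (∏ c, (X - C (u c))) = 0) :
    ∃ Φ : ((Fin n → Fin r) → R) →ₐ[R] A, ∀ i, Φ (fun k => u (k i)) = t i := by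
  let β : (Fin n → Fin r) → A := fun k => ∏ i, aeval (t i) (bpoly R r u (k i))
  have hsum : ∑ k, β k = 1 := by
    have := Finset.prod_univ_sum (fun _ : Fin n => (Finset.univ : Finset (Fin r)))
      fun i c => aeval (t i) (bpoly R r u c)
    rw [Fintype.piFinset_univ] at this
    rw [← this]
    simp [← map_sum, sum_bpoly hr hu]
  have hX : ∀ i k, t i * β k = u (k i) • β k := by
    intro i k
    obtain ⟨a, ha⟩ := X_sub_C_mul_bpoly (u := u) (k i)
    have h0 : (t i - algebraMap R A (u (k i))) * aeval (t i) (bpoly R r u (k i)) = 0 := by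
      have := congrArg (aeval (t i)) ha
      simpa [ht] using this
    have h1 : (t i - algebraMap R A (u (k i))) * β k = 0 := by
      simp only [β]
      rw [← Finset.mul_prod_erase _ _ (Finset.mem_univ i), ← mul_assoc, h0, zero_mul]
    rw [sub_mul, sub_eq_zero, ← Algebra.smul_def] at h1
    exact h1
  have hp : ∀ i k (p : R[X]), aeval (t i) p * β k = p.eval (u (k i)) • β k := by
    intro i k p
    induction p using Polynomial.induction_on' with
    | add p q hp hq => rw [map_add, add_mul, hp, hq, eval_add, add_smul]
    | monomial m a =>
      induction m with
      | zero => simp [Algebra.smul_def]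
      | succ m ih =>
        rw [← monomial_mul_X, map_mul, aeval_X, mul_assoc, hX, mul_smul_comm, ih, eval_mul,
          eval_X, smul_smul, mul_comm]
  have hβ : ∀ k k', β k' * β k = if k' = k then β k else 0 := by
    intro k k'
    have : ∀ s : Finset (Fin n), (∏ i ∈ s, aeval (t i) (bpoly R r u (k' i))) * β k =
        (∏ i ∈ s, (bpoly R r u (k' i)).eval (u (k i))) • β k := by
      intro s
      induction s using Finset.induction_on with
      | empty => simp
      | insert i s hi ih =>
        rw [Finset.prod_insert hi, Finset.prod_insert hi, mul_assoc, ih, mul_smul_comm, hp,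
          smul_smul, mul_comm]
    rw [show β k' = ∏ i, aeval (t i) (bpoly R r u (k' i)) from rfl, this]
    simp only [bpoly_eval hu]
    split_ifs with h
    · simp [h]
    · obtain ⟨i, hi⟩ := Function.ne_iff.1 h
      rw [Finset.prod_eq_zero (Finset.mem_univ i) (by rw [if_neg hi.symm]), zero_smul]
  let L : ((Fin n → Fin r) → R) →ₗ[R] A := Fintype.linearCombination R β
  have hL : ∀ f, L f = ∑ k, f k • β k := fun f => rfl
  refine ⟨AlgHom.ofLinearMap L (by simp [hL, hsum]) fun f f' => ?_, fun i => ?_⟩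
  · simp_rw [hL, Finset.sum_mul_sum, smul_mul_smul_comm, hβ]
    simp
  · rw [AlgHom.ofLinearMap_apply, hL]
    simp_rw [← hX, ← Finset.mul_sum, hsum, mul_one]

open scoped IsMulCommutative in
lemma exists_gridHom [IsDomain R] (hr : 1 ≤ r) (hu : ∀ c c', c ≠ c' → IsUnit (u c - u c'))
    {H : Type*} [Ring H] [Algebra R H] (t : Fin n → H)
    (ht : ∀ i, aeval (t i) (∏ c, (X - C (u c))) = 0) (hc : ∀ i j, t i * t j = t j * t i) :
    ∃ Φ : ((Fin n → Fin r) → R) →ₐ[R] H, ∀ i, Φ (fun k => u (k i)) = t i := by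
  have : IsMulCommutative (Algebra.adjoin R (Set.range t)) := Algebra.isMulCommutative_adjoin R (by
    rintro _ ⟨i, rfl⟩ _ ⟨j, rfl⟩
    exact hc i j)
  let s : Fin n → Algebra.adjoin R (Set.range t) := fun i => ⟨t i, Algebra.subset_adjoin ⟨i, rfl⟩⟩
  obtain ⟨Φ, hΦ⟩ := exists_gridHom_of_comm hr hu s fun i => by
    apply Subtype.val_injective
    rw [← Subalgebra.coe_val, ← aeval_algHom_apply]
    simpa using ht i
  exact ⟨(Algebra.adjoin R (Set.range t)).val.comp Φ, fun i => by simp [hΦ, s]⟩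

variable {H : Type*} [Ring H] [Algebra R H] {Φ : ((Fin n → Fin r) → R) →ₐ[R] H}

lemma aeval_apply_coord {t : Fin n → H} (hΦ : ∀ i, Φ (fun k => u (k i)) = t i) (i : Fin n)
    (p : R[X]) : aeval (t i) p = Φ fun k => p.eval (u (k i)) := by
  rw [← hΦ, aeval_algHom_apply]
  congr 1
  funext k
  simp [aeval_def, eval₂_eq_eval_map]

lemma single_eq_prod (hu : ∀ c c', c ≠ c' → IsUnit (u c - u c')) (k : Fin n → Fin r) :
    (Pi.single k 1 : (Fin n → Fin r) → R) =
      ∏ i, fun k' => (bpoly R r u (k i)).eval (u (k' i)) := by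
  funext k'
  simp only [Finset.prod_apply, bpoly_eval hu, Pi.single_apply]
  split_ifs with h
  · simp [h]
  · obtain ⟨i, hi⟩ := Function.ne_iff.1 h
    rw [Finset.prod_eq_zero (Finset.mem_univ i) (by rw [if_neg hi])]

lemma single_eq_sum (hu : ∀ c c', c ≠ c' → IsUnit (u c - u c')) (k : Fin n → Fin r) :
    (Pi.single k 1 : (Fin n → Fin r) → R) =
      ∑ c ∈ Fintype.piFinset fun _ : Fin n => Finset.range r,
        (∏ i, (bpoly R r u (k i)).coeff (c i)) • ∏ i, (fun k' => u (k' i)) ^ c i := by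
  rw [single_eq_prod hu]
  funext k'
  simp only [Finset.prod_apply, Finset.sum_apply, Pi.smul_apply, Pi.pow_apply, smul_eq_mul,
    ← Finset.prod_mul_distrib]
  rw [← Finset.prod_univ_sum (fun _ => Finset.range r)
    fun i m => (bpoly R r u (k i)).coeff m * u (k' i) ^ m]
  exact Finset.prod_congr rfl fun i _ => eval_eq_sum_range' (natDegree_bpoly_lt _) _

lemma eq_sum_single (f : (Fin n → Fin r) → R) : f = ∑ k, f k • Pi.single k (1 : R) := by
  funext k'
  simp [Pi.single_apply]

lemma mem_adjoin_coord (hu : ∀ c c', c ≠ c' → IsUnit (u c - u c')) (f : (Fin n → Fin r) → R) :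
    f ∈ Algebra.adjoin R (Set.range fun (i : Fin n) (k : Fin n → Fin r) => u (k i)) := by
  rw [eq_sum_single f]
  refine sum_mem fun k _ => Subalgebra.smul_mem _ ?_ _
  rw [single_eq_sum hu]
  refine sum_mem fun c _ => Subalgebra.smul_mem _ (Subalgebra.prod_mem _ fun i _ => ?_) _
  exact Subalgebra.pow_mem _ (Algebra.subset_adjoin (by exact ⟨i, rfl⟩)) _

lemma intertwine_of_coord (hu : ∀ c c', c ≠ c' → IsUnit (u c - u c')) {x : H}
    {σ : Equiv.Perm (Fin n)}
    (hx : ∀ i, x * Φ (fun k => u (k i)) = Φ (fun k => u (k (σ i))) * x)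
    (f : (Fin n → Fin r) → R) : x * Φ f = Φ (fun k => f (k ∘ σ)) * x := by
  have hf := mem_adjoin_coord hu f
  induction hf using Algebra.adjoin_induction with
  | mem f hf => obtain ⟨i, rfl⟩ := hf; exact hx i
  | algebraMap a =>
    have : (fun k : Fin n → Fin r => algebraMap R ((Fin n → Fin r) → R) a (k ∘ σ)) =
      algebraMap R _ a := rfl
    rw [this, AlgHom.commutes, Algebra.commutes]
  | add f f' _ _ h h' =>
    rw [map_add, mul_add, h, h', ← add_mul, ← map_add]
    rfl
  | mul f f' _ _ h h' =>
    rw [map_mul, ← mul_assoc, h, mul_assoc, h', ← mul_assoc, ← map_mul]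
    rfl

lemma braid_expand {σ₁ σ₂ : Equiv.Perm (Fin n)} {x y : H} {E D e : (Fin n → Fin r) → R}
    (hx : ∀ f, x * Φ f = Φ (fun k => f (k ∘ σ₁)) * x)
    (hy : ∀ f, y * Φ f = Φ (fun k => f (k ∘ σ₂)) * y)
    (hxx : x * x = 1 + Φ e * x) :
    (x + Φ E) * (y + Φ D) * (x + Φ E) =
      x * y * x + Φ (fun k => E (k ∘ σ₁ ∘ σ₂)) * (x * y) + Φ E * (y * x) +
      Φ (fun k => D (k ∘ σ₁) * e k + D (k ∘ σ₁) * E (k ∘ σ₁) + E k * D k) * x +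
      Φ (fun k => E k * E (k ∘ σ₂)) * y + Φ (fun k => D (k ∘ σ₁) + E k * D k * E k) := by
  have h1 : x * y * Φ E = Φ (fun k => E (k ∘ σ₁ ∘ σ₂)) * (x * y) := by
    rw [mul_assoc, hy, ← mul_assoc, hx, mul_assoc]
    rfl
  have h2 : x * Φ D * x = Φ (fun k => D (k ∘ σ₁)) + Φ (fun k => D (k ∘ σ₁) * e k) * x := by
    rw [hx, mul_assoc, hxx, mul_add, mul_one, ← mul_assoc, ← map_mul]
    rfl
  have h3 : x * Φ D * Φ E = Φ (fun k => D (k ∘ σ₁) * E (k ∘ σ₁)) * x := by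
    rw [mul_assoc, ← map_mul, hx]
    rfl
  have h4 : Φ E * y * Φ E = Φ (fun k => E k * E (k ∘ σ₂)) * y := by
    rw [mul_assoc, hy, ← mul_assoc, ← map_mul]
    rfl
  have h5 : Φ E * Φ D = Φ (fun k => E k * D k) := (map_mul _ _ _).symm
  have h6 : Φ (fun k => E k * D k) * Φ E = Φ (fun k => E k * D k * E k) := (map_mul _ _ _).symm
  have a1 : Φ (fun k => D (k ∘ σ₁) * e k + D (k ∘ σ₁) * E (k ∘ σ₁) + E k * D k) =
    Φ (fun k => D (k ∘ σ₁) * e k) + Φ (fun k => D (k ∘ σ₁) * E (k ∘ σ₁)) +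
      Φ (fun k => E k * D k) := by
    rw [← map_add, ← map_add]
    rfl
  have a2 : Φ (fun k => D (k ∘ σ₁) + E k * D k * E k) =
    Φ (fun k => D (k ∘ σ₁)) + Φ (fun k => E k * D k * E k) := by
    rw [← map_add]
    rfl
  rw [a1, a2]
  simp only [add_mul, mul_add, h1, h2, h3, h4, h5, h6, mul_assoc (Φ E) y x]
  abel

end Coordinates

end MAK

namespace MAK

section Shift

variable {R : Type*} [CommRing R] {n r : ℕ}

/-- The function on the grid taking the value `h` where the `j`-th coordinate is smaller than the
next one, and `0` elsewhere. -/
def ascent (r : ℕ) (h : R) (j : Fin (n - 1)) (k : Fin n → Fin r) : R :=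
  if k (lo n j) < k (hi n j) then h else 0

/-- The function on the grid taking the value `h` where the `j`-th coordinate equals the next one,
and `0` elsewhere. -/
def level (r : ℕ) (h : R) (j : Fin (n - 1)) (k : Fin n → Fin r) : R :=
  if k (lo n j) = k (hi n j) then h else 0

lemma ascent_comp_simple_of_far (h : R) {i j : Fin (n - 1)}
    (hij : i.1 + 2 ≤ j.1 ∨ j.1 + 2 ≤ i.1) (k : Fin n → Fin r) :
    ascent r h i (k ∘ simple n j) = ascent r h i k := by
  have h1 : simple n j (lo n i) = lo n i :=
    Equiv.swap_apply_of_ne_of_ne (by simp [lo, Fin.ext_iff]; omega)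
      (by simp [lo, hi, Fin.ext_iff]; omega)
  have h2 : simple n j (hi n i) = hi n i :=
    Equiv.swap_apply_of_ne_of_ne (by simp [lo, hi, Fin.ext_iff]; omega)
      (by simp [hi, Fin.ext_iff]; omega)
  simp [ascent, h1, h2]

variable {H : Type*} [Ring H] [Algebra R H] {Φ : ((Fin n → Fin r) → R) →ₐ[R] H} {h : R}
  {T γ : Fin (n - 1) → H}

lemma apply_ascent (h : R) (j : Fin (n - 1)) : Φ (ascent r h j) =
    h • ∑ k ∈ Finset.univ.filter (fun k : Fin n → Fin r => k (lo n j) < k (hi n j)),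
      Φ (Pi.single k 1) := by
  rw [← map_sum, ← map_smul]
  congr 1
  funext k
  simp [ascent, Pi.single_apply]

lemma mul_self_of_sub_mul_add {a b : R} {x : H} (hab : a * b = 1)
    (hx : (x - algebraMap R H a) * (x + algebraMap R H b) = 0) :
    x * x = 1 + (a - b) • x := by
  rw [sub_mul, mul_add, mul_add, ← Algebra.commutes, ← map_mul, hab, map_one,
    ← Algebra.smul_def, ← Algebra.smul_def] at hx
  rw [← sub_eq_zero, ← hx, sub_smul]
  abel

lemma mul_self_of_quad (hT : ∀ j, T j = γ j + Φ (ascent r h j))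
    (inter : ∀ j f, γ j * Φ f = Φ (fun k => f (k ∘ simple n j)) * γ j)
    (quad : ∀ j, T j * T j = 1 + h • T j) (j : Fin (n - 1)) :
    γ j * γ j = 1 + Φ (level r h j) * γ j := by
  have h1 := quad j
  have h2 : Φ (ascent r h j) * Φ (ascent r h j) = h • Φ (ascent r h j) := by
    rw [← map_mul, ← map_smul]
    congr 1
    funext k
    simp only [ascent, Pi.mul_apply, Pi.smul_apply, smul_eq_mul]
    split_ifs <;> ring
  have h3 : Φ (level r h j) = h • (1 : H) - Φ (ascent r h j) -
      Φ (fun k => ascent r h j (k ∘ simple n j)) := by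
    rw [← map_one Φ, ← map_smul, ← map_sub, ← map_sub]
    congr 1
    funext k
    simp only [level, ascent, Pi.sub_apply, Pi.smul_apply, Pi.one_apply, smul_eq_mul,
      Function.comp_apply, simple_lo, simple_hi]
    split_ifs <;> first | omega | ring
  rw [hT, add_mul, mul_add, mul_add, inter, h2, smul_add] at h1
  rw [h3, sub_mul, sub_mul, smul_mul_assoc, one_mul]
  rw [← sub_eq_zero] at h1 ⊢
  rw [← h1]
  abel

lemma braid_of_adj (hT : ∀ j, T j = γ j + Φ (ascent r h j))
    (inter : ∀ j f, γ j * Φ f = Φ (fun k => f (k ∘ simple n j)) * γ j)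
    (quad : ∀ j, γ j * γ j = 1 + Φ (level r h j) * γ j)
    {i j : Fin (n - 1)} (hij : j.1 = i.1 + 1) (braid : T i * T j * T i = T j * T i * T j) :
    γ i * γ j * γ i = γ j * γ i * γ j := by
  have e0 := hi_eq_lo hij
  have e1 : simple n i (lo n i) = lo n j := by rw [simple_lo, e0]
  have e2 : simple n i (lo n j) = lo n i := by rw [← e0, simple_hi]
  have e3 := simple_hi_of_adj hij
  have e4 := simple_lo_of_adj hij
  rw [hT, hT, braid_expand (inter i) (inter j) (quad i),
    braid_expand (inter j) (inter i) (quad j)] at braid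
  have c1 : (fun k => ascent r h i (k ∘ simple n i ∘ simple n j)) = ascent r h j := by
    funext k
    simp only [ascent, Function.comp_apply, e0, e1, e3, e4, simple_lo]
  have c2 : (fun k => ascent r h j (k ∘ simple n j ∘ simple n i)) = ascent r h i := by
    funext k
    simp only [ascent, Function.comp_apply, e0, e2, e3, e4, simple_hi]
  have c3 : (fun k => ascent r h j (k ∘ simple n i) * level r h i k +
      ascent r h j (k ∘ simple n i) * ascent r h i (k ∘ simple n i) +
      ascent r h i k * ascent r h j k) =
      fun k => ascent r h j k * ascent r h j (k ∘ simple n i) := by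
    funext k
    simp only [ascent, level, Function.comp_apply, e0, e1, e2, e3]
    split_ifs <;> first | omega | ring
  have c4 : (fun k => ascent r h i (k ∘ simple n j) * level r h j k +
      ascent r h i (k ∘ simple n j) * ascent r h j (k ∘ simple n j) +
      ascent r h j k * ascent r h i k) =
      fun k => ascent r h i k * ascent r h i (k ∘ simple n j) := by
    funext k
    simp only [ascent, level, Function.comp_apply, e0, e4, simple_lo, simple_hi]
    split_ifs <;> first | omega | ring
  have c5 : (fun k => ascent r h j (k ∘ simple n i) +
      ascent r h i k * ascent r h j k * ascent r h i k) =
      fun k => ascent r h i (k ∘ simple n j) +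
        ascent r h j k * ascent r h i k * ascent r h j k := by
    funext k
    simp only [ascent, Function.comp_apply, e0, e2, e3, e4, simple_lo]
    split_ifs <;> first | omega | ring
  rw [c1, c2, c3, c4, c5] at braid
  rw [← sub_eq_zero] at braid ⊢
  rw [← braid]
  abel

lemma isHeckeFamily_of_quad (hT : ∀ j, T j = γ j + Φ (ascent r h j))
    (inter : ∀ j f, γ j * Φ f = Φ (fun k => f (k ∘ simple n j)) * γ j)
    (quad : ∀ j, T j * T j = 1 + h • T j)
    (braid : ∀ i j : Fin (n - 1), j.1 = i.1 + 1 → T i * T j * T i = T j * T i * T j)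
    (comm : ∀ i j : Fin (n - 1), i.1 + 2 ≤ j.1 ∨ j.1 + 2 ≤ i.1 → T i * T j = T j * T i) :
    IsHeckeFamily Φ γ (level r h) where
  inter := inter
  quad := mul_self_of_quad hT inter quad
  braid i j hij := braid_of_adj hT inter (mul_self_of_quad hT inter quad) hij (braid i j hij)
  comm i j hij := by
    have h1 := comm i j hij
    have h2 : γ i * Φ (ascent r h j) = Φ (ascent r h j) * γ i := by
      simp_rw [inter, ascent_comp_simple_of_far h hij.symm]
    have h3 : γ j * Φ (ascent r h i) = Φ (ascent r h i) * γ j := by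
      simp_rw [inter, ascent_comp_simple_of_far h hij]
    have h4 : Φ (ascent r h i) * Φ (ascent r h j) = Φ (ascent r h j) * Φ (ascent r h i) := by
      rw [← map_mul, mul_comm, map_mul]
    rw [hT, hT, add_mul, add_mul, mul_add, mul_add, mul_add, mul_add, h2, h3, h4] at h1
    rw [← sub_eq_zero] at h1 ⊢
    rw [← h1]
    abel

lemma mul_apply_of_coord {u : Fin r → R} (hu : ∀ c c', c ≠ c' → IsUnit (u c - u c'))
    (hT : ∀ j, T j = γ j + Φ (ascent r h j))
    (hlo : ∀ j, T j * Φ (fun k => u (k (lo n j))) = Φ (fun k => u (k (hi n j))) * T j -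
      Φ fun k => ascent r h j k * (u (k (hi n j)) - u (k (lo n j))))
    (hhi : ∀ j, T j * Φ (fun k => u (k (hi n j))) = Φ (fun k => u (k (lo n j))) * T j +
      Φ fun k => ascent r h j k * (u (k (hi n j)) - u (k (lo n j))))
    (hne : ∀ j i, i ≠ lo n j → i ≠ hi n j →
      T j * Φ (fun k => u (k i)) = Φ (fun k => u (k i)) * T j)
    (j : Fin (n - 1)) (f : (Fin n → Fin r) → R) :
    γ j * Φ f = Φ (fun k => f (k ∘ simple n j)) * γ j := by
  refine intertwine_of_coord hu (fun i => ?_) f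
  have hB : (Φ fun k => ascent r h j k * (u (k (hi n j)) - u (k (lo n j)))) =
      Φ (ascent r h j) * Φ (fun k => u (k (hi n j))) -
        Φ (ascent r h j) * Φ (fun k => u (k (lo n j))) := by
    rw [← mul_sub, ← map_sub, ← map_mul]
    rfl
  have hc : ∀ i, Φ (ascent r h j) * Φ (fun k => u (k i)) =
      Φ (fun k => u (k i)) * Φ (ascent r h j) := fun i => by
    rw [← map_mul, mul_comm, map_mul]
  rw [eq_sub_of_add_eq (hT j).symm, sub_mul, mul_sub]
  by_cases h1 : i = lo n j
  · rw [h1, simple_lo, hlo, hB, hc, hc]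
    abel
  by_cases h2 : i = hi n j
  · rw [h2, simple_hi, hhi, hB, hc, hc]
    abel
  rw [show simple n j i = i from Equiv.swap_apply_of_ne_of_ne h1 h2, hne j i h1 h2, hc]

end Shift

end MAK

namespace MAK

section Relations

variable {R : Type*} [CommRing R] {n r : ℕ} {q Δ : Rˣ} {u : Fin r → R} {F : Fin r → R[X]}

lemma isUnit_sub (hΔ : (Δ : R) =
      ∏ i : Fin r, ∏ j ∈ Finset.univ.filter (fun j => j < i), (u i - u j))
    (c c' : Fin r) (h : c ≠ c') : IsUnit (u c - u c') := by
  have key : ∀ i j : Fin r, j < i → IsUnit (u i - u j) := fun i j hji =>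
    isUnit_of_dvd_unit (((Finset.dvd_prod_of_mem (fun j => u i - u j) (by simpa using hji)).trans
      (Finset.dvd_prod_of_mem (fun i => ∏ j ∈ Finset.univ.filter (fun j => j < i), (u i - u j))
        (Finset.mem_univ i))).trans hΔ.symm.dvd) Δ.isUnit
  rcases lt_or_gt_of_ne h with h | h
  · rw [← neg_sub]
    exact (key _ _ h).neg
  · exact key _ _ h

lemma pim_eq {x y : FA R n} (h : Rel R n r q Δ u F x y) :
    pim R n r q Δ u F x = pim R n r q Δ u F y :=
  RingQuot.mkAlgHom_rel R h

lemma aeval_tt (i : Fin n) (p : R[X]) :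
    aeval (tt R n r q Δ u F i) p = pim R n r q Δ u F (aeval (tf R n i) p) :=
  aeval_algHom_apply _ _ _

lemma tt_root (i : Fin n) : aeval (tt R n r q Δ u F i) (∏ c, (X - C (u c))) = 0 := by
  rw [aeval_tt, pim_eq (Rel.tord i), map_zero]

lemma tt_comm (i i' : Fin n) :
    tt R n r q Δ u F i * tt R n r q Δ u F i' = tt R n r q Δ u F i' * tt R n r q Δ u F i := by
  simpa [tt, TT] using pim_eq (Rel.tcomm (q := q) (Δ := Δ) (u := u) (F := F) i i')

lemma TT_mul_self (j : Fin (n - 1)) : TT R n r q Δ u F j * TT R n r q Δ u F j =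
    1 + ((q : R) - ((q⁻¹ : Rˣ) : R)) • TT R n r q Δ u F j := by
  refine mul_self_of_sub_mul_add q.mul_inv ?_
  simpa [TT] using pim_eq (Rel.quad (q := q) (Δ := Δ) (u := u) (F := F) j)

lemma TT_braid (i j : Fin (n - 1)) (h : j.1 = i.1 + 1) :
    TT R n r q Δ u F i * TT R n r q Δ u F j * TT R n r q Δ u F i =
      TT R n r q Δ u F j * TT R n r q Δ u F i * TT R n r q Δ u F j := by
  simpa [tt, TT] using pim_eq (Rel.braid (q := q) (Δ := Δ) (u := u) (F := F) i j h)

lemma TT_comm (i j : Fin (n - 1)) (h : i.1 + 2 ≤ j.1 ∨ j.1 + 2 ≤ i.1) :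
    TT R n r q Δ u F i * TT R n r q Δ u F j = TT R n r q Δ u F j * TT R n r q Δ u F i := by
  simpa [tt, TT] using pim_eq (Rel.Tcomm (q := q) (Δ := Δ) (u := u) (F := F) i j h)

variable {Φ : ((Fin n → Fin r) → R) →ₐ[R] Hnr R n r q Δ u F}

lemma b_eq (hu : ∀ c c', c ≠ c' → IsUnit (u c - u c'))
    (hΦ : ∀ i, Φ (fun k => u (k i)) = tt R n r q Δ u F i) (k : Fin n → Fin r) :
    b R n r q Δ u F k = Φ (Pi.single k 1) := by
  rw [single_eq_prod hu, ← List.prod_ofFn, map_list_prod, List.map_ofFn, b]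
  simp only [aeval_apply_coord hΦ]
  rfl

lemma tmon_eq (hΦ : ∀ i, Φ (fun k => u (k i)) = tt R n r q Δ u F i) (c : Fin n → ℕ) :
    tmon R n r q Δ u F c = Φ (∏ i, (fun k => u (k i)) ^ c i) := by
  rw [← List.prod_ofFn, map_list_prod, List.map_ofFn, tmon]
  simp only [Function.comp_def, map_pow, hΦ]

lemma TT_eq (hu : ∀ c c', c ≠ c' → IsUnit (u c - u c'))
    (hΦ : ∀ i, Φ (fun k => u (k i)) = tt R n r q Δ u F i) (j : Fin (n - 1)) :
    TT R n r q Δ u F j = g R n r q Δ u F j + Φ (ascent r ((q : R) - ((q⁻¹ : Rˣ) : R)) j) := by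
  rw [apply_ascent, g, B']
  simp only [b_eq hu hΦ]
  exact (neg_add_cancel_right _ _).symm

lemma pim_Bel (hΦ : ∀ i, Φ (fun k => u (k i)) = tt R n r q Δ u F i)
    (hFeval : ∀ c c' : Fin r, (F c).eval (u c') = if c' = c then (Δ : R) else 0)
    (j : Fin (n - 1)) :
    pim R n r q Δ u F (Bel R n r q Δ u F j) = Φ fun k =>
      ascent r ((q : R) - ((q⁻¹ : Rˣ) : R)) j k * (u (k (hi n j)) - u (k (lo n j))) := by
  simp only [Bel, map_sum, map_smul, map_mul, ← aeval_tt, aeval_apply_coord hΦ]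
  simp only [← map_mul, ← map_smul, ← map_sum]
  congr 1
  funext k
  have hinv : ((Δ⁻¹ : Rˣ) : R) ^ 2 * ((Δ : R) * Δ) = 1 := by
    rw [← sq, ← mul_pow, Units.inv_mul, one_pow]
  simp only [Finset.sum_apply, Pi.smul_apply, Pi.mul_apply, smul_eq_mul, hFeval]
  rw [Finset.sum_eq_single (k (hi n j)) (fun c _ hc => by simp [hc.symm]) (by simp),
    Finset.sum_filter, Finset.sum_eq_single (k (lo n j)) (fun c _ hc => by simp [hc.symm])
      (by simp), if_pos rfl, if_pos rfl, ascent]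
  split_ifs
  · linear_combination ((q : R) - ((q⁻¹ : Rˣ) : R)) * (u (k (hi n j)) - u (k (lo n j))) * hinv
  · rw [zero_mul]

lemma isHeckeFamily_g (hu : ∀ c c', c ≠ c' → IsUnit (u c - u c'))
    (hFeval : ∀ c c' : Fin r, (F c).eval (u c') = if c' = c then (Δ : R) else 0)
    (hΦ : ∀ i, Φ (fun k => u (k i)) = tt R n r q Δ u F i) :
    IsHeckeFamily Φ (g R n r q Δ u F) (level r ((q : R) - ((q⁻¹ : Rˣ) : R))) := by
  refine isHeckeFamily_of_quad (TT_eq hu hΦ) (mul_apply_of_coord hu (TT_eq hu hΦ) ?_ ?_ ?_)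
    TT_mul_self TT_braid TT_comm
  · intro j
    rw [hΦ, hΦ, ← pim_Bel hΦ hFeval]
    simpa [tt, TT] using pim_eq (Rel.Tlo (q := q) (Δ := Δ) (u := u) (F := F) j)
  · intro j
    rw [hΦ, hΦ, ← pim_Bel hΦ hFeval]
    simpa [tt, TT] using pim_eq (Rel.Thi (q := q) (Δ := Δ) (u := u) (F := F) j)
  · intro j i h1 h2
    rw [hΦ]
    simpa [tt, TT] using pim_eq (Rel.Tt (q := q) (Δ := Δ) (u := u) (F := F) j i h1 h2)

lemma adjoin_eq_top (hu : ∀ c c', c ≠ c' → IsUnit (u c - u c'))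
    (hΦ : ∀ i, Φ (fun k => u (k i)) = tt R n r q Δ u F i) :
    Algebra.adjoin R (Set.range Φ ∪ Set.range (g R n r q Δ u F)) = ⊤ := by
  rw [eq_top_iff]
  intro x _
  obtain ⟨a, rfl⟩ := RingQuot.mkAlgHom_surjective R (Rel R n r q Δ u F) x
  have hmem : ∀ f, Φ f ∈ Algebra.adjoin R (Set.range Φ ∪ Set.range (g R n r q Δ u F)) :=
    fun f => Algebra.subset_adjoin (Or.inl ⟨f, rfl⟩)
  induction a using FreeAlgebra.induction with
  | grade0 a =>
    rw [AlgHom.commutes]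
    exact Subalgebra.algebraMap_mem _ a
  | grade1 i =>
    rcases i with i | j
    · change tt R n r q Δ u F i ∈ _
      rw [← hΦ]
      exact hmem _
    · change TT R n r q Δ u F j ∈ _
      rw [TT_eq hu hΦ]
      exact add_mem (Algebra.subset_adjoin (Or.inr ⟨j, rfl⟩)) (hmem _)
  | mul a a' h h' =>
    rw [map_mul]
    exact mul_mem (h trivial) (h' trivial)
  | add a a' h h' =>
    rw [map_add]
    exact add_mem (h trivial) (h' trivial)

/-- The constant coefficient of the Lagrange basis polynomial of the grid point `k`. -/
noncomputable def weight (u : Fin r → R) (k : Fin n → Fin r) : R :=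
  ∏ i, (bpoly R r u (k i)).coeff 0

lemma weight_comp (σ : Equiv.Perm (Fin n)) (k : Fin n → Fin r) :
    weight u (k ∘ σ) = weight u k :=
  Equiv.prod_comp σ fun i => (bpoly R r u (k i)).coeff 0

lemma apply_mul_gword (hr : 1 ≤ r) (hu : ∀ c c', c ≠ c' → IsUnit (u c - u c'))
    (hΦ : ∀ i, Φ (fun k => u (k i)) = tt R n r q Δ u F i) {τ : Hnr R n r q Δ u F →ₗ[R] R}
    (hτ : ∀ c : Fin n → ℕ, (∀ i, c i ≤ r - 1) →
      ∀ (w : Equiv.Perm (Fin n)) (l : List (Fin (n - 1))), IsReducedWord n w l →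
        τ (tmon R n r q Δ u F c * gword R n r q Δ u F l) = if w = 1 ∧ c = 0 then 1 else 0)
    (f : (Fin n → Fin r) → R) (w : Equiv.Perm (Fin n)) (l : List (Fin (n - 1)))
    (hl : IsReducedWord n w l) :
    τ (Φ f * gword R n r q Δ u F l) = if w = 1 then ∑ k, f k * weight u k else 0 := by
  have key : ∀ k, τ (Φ (Pi.single k 1) * gword R n r q Δ u F l) =
      if w = 1 then weight u k else 0 := by
    intro k
    rw [single_eq_sum hu, map_sum, Finset.sum_mul, map_sum]
    calc
      _ = ∑ c ∈ Fintype.piFinset fun _ : Fin n => Finset.range r,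
          (∏ i, (bpoly R r u (k i)).coeff (c i)) * if w = 1 ∧ c = 0 then 1 else 0 := by
        refine Finset.sum_congr rfl fun c hc => ?_
        rw [map_smul, ← tmon_eq hΦ, smul_mul_assoc, map_smul, smul_eq_mul, hτ c _ w l hl]
        intro i
        have := Finset.mem_range.1 (Fintype.mem_piFinset.1 hc i)
        omega
      _ = _ := by
        rw [Finset.sum_eq_single 0]
        · simp [weight]
        · intro c _ hc
          simp [hc]
        · intro h
          exact absurd (Fintype.mem_piFinset.2 fun i => Finset.mem_range.2 hr) h
  conv_lhs => rw [eq_sum_single f]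
  simp only [map_sum, Finset.sum_mul, map_smul, smul_mul_assoc, key, smul_eq_mul]
  split_ifs <;> simp

end Relations

end MAK

/-- Corollary 4.2: `τ` is a trace form on `H_{n,r}`. -/
theorem statement14
    (R : Type*) [CommRing R] [IsDomain R] (n r : ℕ) (hn : 1 ≤ n) (hr : 1 ≤ r)
    (q Δ : Rˣ) (u : Fin r → R) (F : Fin r → R[X])
    (hΔ : (Δ : R) = ∏ i : Fin r, ∏ j ∈ Finset.univ.filter (fun j => j < i), (u i - u j))
    (hFdeg : ∀ c : Fin r, (F c).degree = ((r - 1 : ℕ) : WithBot ℕ))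
    (hFeval : ∀ c c' : Fin r, (F c).eval (u c') = if c' = c then (Δ : R) else 0)
    (τ : Hnr R n r q Δ u F →ₗ[R] R)
    (hτ : ∀ c : Fin n → ℕ, (∀ i, c i ≤ r - 1) →
      ∀ (w : Equiv.Perm (Fin n)) (l : List (Fin (n - 1))), IsReducedWord n w l →
        τ (tmon R n r q Δ u F c * gword R n r q Δ u F l) = if w = 1 ∧ c = 0 then 1 else 0) :
    ∀ x y : Hnr R n r q Δ u F, τ (x * y) = τ (y * x) := by
  have hu := isUnit_sub hΔ
  obtain ⟨Φ, hΦ⟩ := exists_gridHom hr hu (tt R n r q Δ u F) tt_root tt_comm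
  exact (isHeckeFamily_g hu hFeval hΦ).trace_mul_comm (adjoin_eq_top hu hΦ)
    (fun j k => weight_comp (simple n j) k) (apply_mul_gword hr hu hΦ hτ)
end

section
/- For every 0 ≤ s ≤ r−1, the constant coefficient of the unique polynomial of degree < r congruent to X^{r+s} modulo (X − u_1)⋯(X − u_r) equals (−1)^{r+1}·σ_r·h_s, where σ_r = u_1⋯u_r and h_s is the complete homogeneous symmetric polynomial of degree s in u_1,…,u_r. Equivalently, in A := R[X]/((X − u_1)⋯(X − u_r)) with t the image of X and τ₀ : A → R the R-linear map reading off the coefficient of 1 with respect to the basis 1, t, …, t^{r−1}, one has τ₀(t^{r+s}) = (−1)^{r+1}·σ_r·h_s. -/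
noncomputable section

open Polynomial

/-- `h_s(u_1,…,u_r)`: the `s`-th complete homogeneous symmetric polynomial
evaluated at `u_1,…,u_r`. -/
def hsym (R : Type*) [CommRing R] (r : ℕ) (u : Fin r → R) (s : ℕ) : R :=
  ∑ m : Sym (Fin r) s, ((m : Multiset (Fin r)).map u).prod

theorem hsym_zero (R : Type*) [CommRing R] (r : ℕ) (u : Fin r → R) : hsym R r u 0 = 1 := by
  simp [hsym, Sym.eq_nil_of_card_zero]

theorem hsym_fin_zero_succ (R : Type*) [CommRing R] (u : Fin 0 → R) (s : ℕ) :
    hsym R 0 u (s + 1) = 0 := by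
  simp [hsym]

/-- The multisets of size `s + 1` on `Fin (r + 1)` split according to whether they contain `0`. -/
def symFinSuccEquiv (r s : ℕ) :
    Sym (Fin (r + 1)) s ⊕ Sym (Fin r) (s + 1) ≃ Sym (Fin (r + 1)) (s + 1) :=
  ((Sym.equivCongr (finSuccEquiv r)).sumCongr (Equiv.refl _)).trans
    (symOptionSuccEquiv.symm.trans (Sym.equivCongr (finSuccEquiv r).symm))

theorem coe_symFinSuccEquiv_inl (r s : ℕ) (m : Sym (Fin (r + 1)) s) :
    (symFinSuccEquiv r s (Sum.inl m) : Multiset (Fin (r + 1))) = 0 ::ₘ m := by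
  simp [symFinSuccEquiv, symOptionSuccEquiv, Sym.equivCongr, Sym.coe_cons]

theorem coe_symFinSuccEquiv_inr (r s : ℕ) (m : Sym (Fin r) (s + 1)) :
    (symFinSuccEquiv r s (Sum.inr m) : Multiset (Fin (r + 1))) =
      (m : Multiset (Fin r)).map Fin.succ := by
  simp [symFinSuccEquiv, symOptionSuccEquiv, Sym.equivCongr]

theorem hsym_succ_succ (R : Type*) [CommRing R] (r : ℕ) (u : Fin (r + 1) → R) (s : ℕ) :
    hsym R (r + 1) u (s + 1) =
      u 0 * hsym R (r + 1) u s + hsym R r (fun i => u i.succ) (s + 1) := by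
  simp only [hsym]
  rw [← (symFinSuccEquiv r s).sum_comp, Fintype.sum_sum_type, Finset.mul_sum]
  simp only [coe_symFinSuccEquiv_inl, coe_symFinSuccEquiv_inr, Multiset.map_cons,
    Multiset.prod_cons, Multiset.map_map, Function.comp_def]

/-- The polynomial `∑_{j ≤ n} h_j(u) X ^ (n - j)`. -/
def hsymPoly (R : Type*) [CommRing R] (r : ℕ) (u : Fin r → R) : ℕ → R[X]
  | 0 => C (hsym R r u 0)
  | n + 1 => X * hsymPoly R r u n + C (hsym R r u (n + 1))

theorem coeff_zero_hsymPoly (R : Type*) [CommRing R] (r : ℕ) (u : Fin r → R) (n : ℕ) :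
    (hsymPoly R r u n).coeff 0 = hsym R r u n := by
  cases n <;> simp [hsymPoly]

theorem hsymPoly_fin_zero (R : Type*) [CommRing R] (u : Fin 0 → R) (n : ℕ) :
    hsymPoly R 0 u n = X ^ n := by
  induction n with
  | zero => simp [hsymPoly, hsym_zero]
  | succ n ih => simp [hsymPoly, ih, hsym_fin_zero_succ, pow_succ']

theorem X_sub_C_mul_hsymPoly (R : Type*) [CommRing R] (r : ℕ) (u : Fin (r + 1) → R) (n : ℕ) :
    (X - C (u 0)) * hsymPoly R (r + 1) u n =
      hsymPoly R r (fun i => u i.succ) (n + 1) - C (hsym R (r + 1) u (n + 1)) := by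
  induction n with
  | zero =>
    simp only [hsymPoly, hsym_succ_succ, hsym_zero, map_add, map_mul, map_one]
    ring
  | succ n ih =>
    rw [hsymPoly, hsymPoly, hsym_succ_succ R r u (n + 1), map_add, map_mul]
    linear_combination X * ih

theorem monic_prod_univ_X_sub_C (R : Type*) [CommRing R] (r : ℕ) (u : Fin r → R) :
    (∏ c : Fin r, (X - C (u c))).Monic :=
  monic_prod_of_monic _ _ fun i _ => monic_X_sub_C (u i)

theorem degree_prod_univ_X_sub_C (R : Type*) [CommRing R] [Nontrivial R] (r : ℕ)
    (u : Fin r → R) : degree (∏ c : Fin r, (X - C (u c))) = (r : WithBot ℕ) := by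
  rw [degree_prod_of_monic _ _ fun i _ => monic_X_sub_C (u i)]
  simp

theorem degree_X_pow_sub_prod_mul_hsymPoly_lt (R : Type*) [CommRing R] (r : ℕ)
    (u : Fin r → R) (n : ℕ) :
    degree (X ^ (r + n) - (∏ c : Fin r, (X - C (u c))) * hsymPoly R r u n) < r := by
  induction r generalizing n with
  | zero => simp [hsymPoly_fin_zero]
  | succ r ih =>
    nontriviality R
    have key : X ^ (r + 1 + n) - (∏ c : Fin (r + 1), (X - C (u c))) * hsymPoly R (r + 1) u n =
        (X ^ (r + (n + 1)) - (∏ c : Fin r, (X - C (u c.succ))) *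
          hsymPoly R r (fun i => u i.succ) (n + 1)) +
        C (hsym R (r + 1) u (n + 1)) * ∏ c : Fin r, (X - C (u c.succ)) := by
      rw [Fin.prod_univ_succ, show r + 1 + n = r + (n + 1) by ring]
      linear_combination
        (-∏ c : Fin r, (X - C (u c.succ))) * X_sub_C_mul_hsymPoly R r u n
    have hlt : (r : WithBot ℕ) < (r + 1 : ℕ) := by exact_mod_cast Nat.lt_succ_self r
    rw [key]
    refine (degree_add_le _ _).trans_lt (max_lt ((ih _ _).trans hlt) (lt_of_le_of_lt ?_ hlt))
    rw [← smul_eq_C_mul]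
    exact (degree_smul_le _ _).trans (degree_prod_univ_X_sub_C R r _).le

theorem X_pow_modByMonic_prod_X_sub_C (R : Type*) [CommRing R] (r : ℕ) (u : Fin r → R) (n : ℕ) :
    (X : R[X]) ^ (r + n) %ₘ ∏ c : Fin r, (X - C (u c)) =
      X ^ (r + n) - (∏ c : Fin r, (X - C (u c))) * hsymPoly R r u n := by
  nontriviality R
  refine (div_modByMonic_unique (hsymPoly R r u n) _
    (monic_prod_univ_X_sub_C R r u) ⟨by ring, ?_⟩).2
  rw [degree_prod_univ_X_sub_C]
  exact degree_X_pow_sub_prod_mul_hsymPoly_lt R r u n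

/-- Lemma 4.4: the constant coefficient of the remainder of `X^{r+s}` modulo
`(X - u_1)⋯(X - u_r)` equals `(-1)^{r+1} σ_r h_s`. -/
theorem statement15 (R : Type*) [CommRing R] [IsDomain R] (r : ℕ) (hr : 1 ≤ r)
    (u : Fin r → R) (s : ℕ) (hs : s ≤ r - 1) :
    ((X : R[X]) ^ (r + s) %ₘ ∏ c : Fin r, (X - C (u c))).coeff 0 =
      (-1) ^ (r + 1) * (∏ i : Fin r, u i) * hsym R r u s := by
  rw [X_pow_modByMonic_prod_X_sub_C, coeff_sub, mul_coeff_zero, coeff_zero_hsymPoly,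
    coeff_zero_prod, coeff_X_pow, if_neg (by omega)]
  simp [Finset.prod_neg, pow_succ]
end
end
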